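/- arXiv:1707.08591 — 2 statements merged into one kernel-verified Lean document; each statement's English description precedes it below -/
import Mathlib

section
/- Let × be a cross product on a real inner product space V and let N ∈ V be a unit vector. Then for all X, Y ∈ V with ⟨X, N⟩ = 0 and ⟨Y, N⟩ = 0 one has N × (X × (N × Y)) = X × Y − ⟨X × Y, N⟩ N. In particular, for every Z orthogonal to N, ⟨N × (X × (N × Y)), Z⟩ = ⟨X × Y, Z⟩. -/
open RealInnerProductSpace

section CrossProduct

variable {V : Type*} [NormedAddCommGroup V] [InnerProductSpace ℝ V]

/-- The triple product of a cross product is skew in its last two arguments. -/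
theorem inner_cross_right_swap {cross : V →ₗ[ℝ] V →ₗ[ℝ] V}
    (h : ∀ A B : V, ⟪cross A B, B⟫ = 0) (A B C : V) :
    ⟪cross A B, C⟫ = -⟪cross A C, B⟫ := by
  have key := h A (B + C)
  simp only [map_add, inner_add_left, inner_add_right, h] at key
  linarith

/-- Polarization of the norm identity of a cross product in the second argument. -/
theorem inner_cross_cross_same_left {cross : V →ₗ[ℝ] V →ₗ[ℝ] V}
    (h : ∀ A B : V, ‖cross A B‖ ^ 2 = ‖A‖ ^ 2 * ‖B‖ ^ 2 - ⟪A, B⟫ ^ 2) (A B C : V) :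
    ⟪cross A B, cross A C⟫ = ‖A‖ ^ 2 * ⟪B, C⟫ - ⟪A, B⟫ * ⟪A, C⟫ := by
  have key := h A (B + C)
  rw [map_add, norm_add_sq_real, norm_add_sq_real, inner_add_right, h A B, h A C] at key
  linarith

theorem cross_cross_same {cross : V →ₗ[ℝ] V →ₗ[ℝ] V}
    (h₂ : ∀ A B : V, ⟪cross A B, B⟫ = 0)
    (h₃ : ∀ A B : V, ‖cross A B‖ ^ 2 = ‖A‖ ^ 2 * ‖B‖ ^ 2 - ⟪A, B⟫ ^ 2) (A B : V) :
    cross A (cross A B) = ⟪A, B⟫ • A - ⟪A, A⟫ • B := by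
  refine ext_inner_right ℝ fun C => ?_
  rw [inner_cross_right_swap h₂, real_inner_comm, inner_cross_cross_same_left h₃, inner_sub_left,
    real_inner_smul_left, real_inner_smul_left, real_inner_self_eq_norm_sq]
  ring

/-- Linearization of `cross_cross_same` in the repeated argument. -/
theorem cross_cross_add_cross_cross {cross : V →ₗ[ℝ] V →ₗ[ℝ] V}
    (h₂ : ∀ A B : V, ⟪cross A B, B⟫ = 0)
    (h₃ : ∀ A B : V, ‖cross A B‖ ^ 2 = ‖A‖ ^ 2 * ‖B‖ ^ 2 - ⟪A, B⟫ ^ 2) (A B C : V) :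
    cross A (cross B C) + cross B (cross A C) =
      ⟪A, C⟫ • B + ⟪B, C⟫ • A - (2 * ⟪A, B⟫) • C := by
  have key := cross_cross_same h₂ h₃ (A + B) C
  simp only [map_add, LinearMap.add_apply, inner_add_left, inner_add_right,
    cross_cross_same h₂ h₃ A C, cross_cross_same h₂ h₃ B C, real_inner_comm A B] at key
  linear_combination (norm := module) key

theorem cross_self_of_norm_sq_cross {cross : V →ₗ[ℝ] V →ₗ[ℝ] V}
    (h : ∀ A B : V, ‖cross A B‖ ^ 2 = ‖A‖ ^ 2 * ‖B‖ ^ 2 - ⟪A, B⟫ ^ 2) (A : V) :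
    cross A A = 0 := by
  have key := h A A
  rw [real_inner_self_eq_norm_sq] at key
  rw [← norm_eq_zero, ← sq_eq_zero_iff, key]
  ring

end CrossProduct

/-- For a cross product on a real inner product space, a unit
vector `N`, and vectors `X, Y` orthogonal to `N`, one has
`N × (X × (N × Y)) = X × Y − ⟪X × Y, N⟫ N`; in particular the two sides have
the same inner product with every `Z` orthogonal to `N`. -/
theorem cross_characteristic_connection_key_identity
    {V : Type*} [NormedAddCommGroup V] [InnerProductSpace ℝ V]
    (cross : V →ₗ[ℝ] V →ₗ[ℝ] V)
    (h₁ : ∀ A B : V, ⟪cross A B, A⟫ = 0)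
    (h₂ : ∀ A B : V, ⟪cross A B, B⟫ = 0)
    (h₃ : ∀ A B : V, ‖cross A B‖ ^ 2 = ‖A‖ ^ 2 * ‖B‖ ^ 2 - ⟪A, B⟫ ^ 2)
    (N : V) (hN : ‖N‖ = 1)
    (X Y : V) (hX : ⟪X, N⟫ = 0) (hY : ⟪Y, N⟫ = 0) :
    cross N (cross X (cross N Y)) = cross X Y - ⟪cross X Y, N⟫ • N ∧
    ∀ Z : V, ⟪Z, N⟫ = 0 →
      ⟪cross N (cross X (cross N Y)), Z⟫ = ⟪cross X Y, Z⟫ := by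
  have swap : cross X (cross N Y) = ⟪X, Y⟫ • N - cross N (cross X Y) := by
    have key := cross_cross_add_cross_cross h₂ h₃ X N Y
    rw [real_inner_comm] at hY
    rw [hX, hY, mul_zero, zero_smul, zero_smul, add_zero, sub_zero] at key
    exact eq_sub_of_add_eq key
  have main : cross N (cross X (cross N Y)) = cross X Y - ⟪cross X Y, N⟫ • N := by
    rw [swap, map_sub, map_smul, cross_self_of_norm_sq_cross h₃, cross_cross_same h₂ h₃,
      real_inner_self_eq_norm_sq, hN, real_inner_comm N (cross X Y)]
    module
  refine ⟨main, fun Z hZ => ?_⟩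
  rw [main, inner_sub_left, real_inner_smul_left, real_inner_comm Z N, hZ, mul_zero, sub_zero]
end

section
/- Let × be a cross product on a real inner product space V and let N ∈ V be a unit vector. Define T(X,Y,Z) := −⟨N × (X × Y), Z⟩. Then T(X,Y,Z) = −⟨N, (X × Y) × Z⟩ for all X, Y, Z ∈ V, and T restricted to the orthogonal complement of N is a totally antisymmetric trilinear form (a 3-form): T(X,X,Z) = 0 and T(X,Y,Y) = 0 whenever X, Y, Z are orthogonal to N. This is the torsion 3-form of the characteristic connection of the nearly Kähler sphere S⁶ = G₂/SU(3). -/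
open RealInnerProductSpace

section CrossProduct

variable {V : Type*} [NormedAddCommGroup V] [InnerProductSpace ℝ V] {cross : V →ₗ[ℝ] V →ₗ[ℝ] V}

/-- The trilinear form `⟪A × B, C⟫` is invariant under cyclic permutations. -/
theorem inner_cross_cyclic
    (h₁ : ∀ A B : V, ⟪cross A B, A⟫ = 0) (h₂ : ∀ A B : V, ⟪cross A B, B⟫ = 0) (A B C : V) :
    ⟪cross A B, C⟫ = ⟪cross B C, A⟫ := by
  have swap_last := h₂ A (B + C)
  have swap_outer := h₁ (A + B) C
  simp only [map_add, LinearMap.add_apply, inner_add_left, inner_add_right, h₁, h₂]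
    at swap_last swap_outer
  linarith

theorem cross_apply_self
    (h₃ : ∀ A B : V, ‖cross A B‖ ^ 2 = ‖A‖ ^ 2 * ‖B‖ ^ 2 - ⟪A, B⟫ ^ 2) (A : V) :
    cross A A = 0 := by
  have h := h₃ A A
  rw [real_inner_self_eq_norm_sq] at h
  have hz : ‖cross A A‖ ^ 2 = 0 := by rw [h]; ring
  exact norm_eq_zero.mp (pow_eq_zero_iff two_ne_zero |>.mp hz)

/-- Polarization of the norm identity in the second argument. -/
theorem inner_cross_cross
    (h₃ : ∀ A B : V, ‖cross A B‖ ^ 2 = ‖A‖ ^ 2 * ‖B‖ ^ 2 - ⟪A, B⟫ ^ 2) (A B C : V) :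
    ⟪cross A B, cross A C⟫ = ‖A‖ ^ 2 * ⟪B, C⟫ - ⟪A, B⟫ * ⟪A, C⟫ := by
  have h := h₃ A (B + C)
  rw [map_add, norm_add_sq_real, norm_add_sq_real, inner_add_right, h₃, h₃] at h
  linarith

theorem cross_apply_anticomm
    (h₃ : ∀ A B : V, ‖cross A B‖ ^ 2 = ‖A‖ ^ 2 * ‖B‖ ^ 2 - ⟪A, B⟫ ^ 2) (A B : V) :
    cross A B = -cross B A := by
  have h := cross_apply_self h₃ (A + B)
  simp only [map_add, LinearMap.add_apply, cross_apply_self h₃, zero_add, add_zero] at h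
  exact eq_neg_of_add_eq_zero_right h

end CrossProduct

/-- For a cross product on a real inner product space and a unit
vector `N`, the form `T(X,Y,Z) := −⟪N × (X × Y), Z⟫` satisfies
`T(X,Y,Z) = −⟪N, (X × Y) × Z⟫`, and its restriction to the orthogonal
complement of `N` is totally antisymmetric: `T(X,X,Z) = 0` and `T(X,Y,Y) = 0`
for `X, Y, Z` orthogonal to `N`. -/
theorem cross_torsion_three_form
    {V : Type*} [NormedAddCommGroup V] [InnerProductSpace ℝ V]
    (cross : V →ₗ[ℝ] V →ₗ[ℝ] V)
    (h₁ : ∀ A B : V, ⟪cross A B, A⟫ = 0)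
    (h₂ : ∀ A B : V, ⟪cross A B, B⟫ = 0)
    (h₃ : ∀ A B : V, ‖cross A B‖ ^ 2 = ‖A‖ ^ 2 * ‖B‖ ^ 2 - ⟪A, B⟫ ^ 2)
    (N : V) (hN : ‖N‖ = 1)
    (T : V → V → V → ℝ)
    (hT : ∀ X Y Z : V, T X Y Z = -⟪cross N (cross X Y), Z⟫) :
    (∀ X Y Z : V, T X Y Z = -⟪N, cross (cross X Y) Z⟫) ∧
    (∀ X Z : V, ⟪X, N⟫ = 0 → ⟪Z, N⟫ = 0 → T X X Z = 0) ∧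
    (∀ X Y : V, ⟪X, N⟫ = 0 → ⟪Y, N⟫ = 0 → T X Y Y = 0) := by
  refine ⟨fun X Y Z => ?_, fun X Z _ _ => ?_, fun X Y hX hY => ?_⟩
  · rw [hT, inner_cross_cyclic h₁ h₂, real_inner_comm]
  · rw [hT, cross_apply_self h₃, map_zero, inner_zero_left, neg_zero]
  · rw [hT, ← inner_cross_cyclic h₁ h₂ Y, cross_apply_anticomm h₃ X Y, inner_neg_right,
      inner_cross_cross h₃, real_inner_comm, hX, hY]
    ring
end
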